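/- Every antisymmetric cone admits an order-embedding into a normally divisible refinement cone satisfying the axiom (WSD). -/

import Mathlib

universe u

/-- Conical commutative monoid ("cone"): `x + y = 0` implies `x = y = 0`. -/
def IsConical (M : Type u) [AddCommMonoid M] : Prop :=
  ∀ x y : M, x + y = 0 → x = 0 ∧ y = 0

/-- Algebraic preorder: `x ≤ y` iff `∃ z, x + z = y`. -/
def AlgLE {M : Type u} [AddCommMonoid M] (x y : M) : Prop :=
  ∃ z : M, x + z = y

/-- Refinement monoid. -/
def IsRefinementMonoid (M : Type u) [AddCommMonoid M] : Prop :=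
  ∀ a₀ a₁ b₀ b₁ : M, a₀ + a₁ = b₀ + b₁ →
    ∃ c₀₀ c₀₁ c₁₀ c₁₁ : M,
      a₀ = c₀₀ + c₀₁ ∧ a₁ = c₁₀ + c₁₁ ∧ b₀ = c₀₀ + c₁₀ ∧ b₁ = c₀₁ + c₁₁

/-- Unitary homomorphism: injective, cofinal image, and `f a₀ + b = f a₁ → b ∈ range f`. -/
def IsUnitary {A : Type u} {B : Type u} [AddCommMonoid A] [AddCommMonoid B]
    (f : A →+ B) : Prop :=
  Function.Injective f ∧
  (∀ b : B, ∃ a : A, AlgLE b (f a)) ∧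
  (∀ a₀ a₁ : A, ∀ b : B, f a₀ + b = f a₁ → b ∈ Set.range f)

/-- Strongly unitary homomorphism. -/
def IsStronglyUnitary {A : Type u} {B : Type u} [AddCommMonoid A] [AddCommMonoid B]
    (f : A →+ B) : Prop :=
  IsUnitary f ∧ ∀ m : ℕ, 0 < m → ∀ b : B, m • b ∈ Set.range f → b ∈ Set.range f

/-- Normally divisible commutative monoid. -/
def IsNormallyDivisible (M : Type u) [AddCommMonoid M] : Prop :=
  ∀ p : ℕ, 0 < p → ∀ X : Finset M, ∀ a : M,
    ∃ u : M, p • u = a ∧ ∀ x ∈ X, ∀ y ∈ X, x + a = y + a → x + u = y + u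

/-- Order-embedding of commutative monoids (w.r.t. the algebraic preorders). -/
def IsOrderEmbeddingHom {A : Type u} {B : Type u} [AddCommMonoid A] [AddCommMonoid B]
    (f : A →+ B) : Prop :=
  Function.Injective f ∧ ∀ x y : A, AlgLE x y ↔ AlgLE (f x) (f y)

/-- Simple commutative monoid: every `u ≰ 0` is an order-unit. -/
def IsSimpleMonoid (M : Type u) [AddCommMonoid M] : Prop :=
  ∀ u : M, ¬ AlgLE u 0 → ∀ x : M, ∃ n : ℕ, 0 < n ∧ AlgLE x (n • u)

/-- Weak sum decomposition axiom (WSD). -/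
def WSD (M : Type u) [AddCommMonoid M] : Prop :=
  ∀ a₀ a₁ b c : M, a₀ + a₁ + c = b + c →
    ∃ x₀ x₁ : M, a₀ + c = x₀ + c ∧ a₁ + c = x₁ + c ∧ b = x₀ + x₁

/-- `a ∝ b` : `a ≤ n • b` for some positive integer `n`. -/
def Propto {M : Type u} [AddCommMonoid M] (a b : M) : Prop :=
  ∃ n : ℕ, 0 < n ∧ AlgLE a (n • b)

/-- `a ≍ b` : `a ∝ b` and `b ∝ a`. -/
def Asymp {M : Type u} [AddCommMonoid M] (a b : M) : Prop :=
  Propto a b ∧ Propto b a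

/-- Cancellative commutative monoid. -/
def IsCancellativeMonoid (M : Type u) [AddCommMonoid M] : Prop :=
  ∀ x y z : M, x + z = y + z → x = y

/-- Separative commutative monoid. -/
def IsSeparative (M : Type u) [AddCommMonoid M] : Prop :=
  ∀ x y : M, 2 • x = x + y → x + y = 2 • y → x = y

/-- Stably finite commutative monoid. -/
def IsStablyFinite (M : Type u) [AddCommMonoid M] : Prop :=
  ∀ x y : M, x + y = y → x = 0

/-- Quasi-divisible commutative monoid. -/
def IsQuasiDivisible (M : Type u) [AddCommMonoid M] : Prop :=
  ∀ x : M, ∃ u v : M, 2 • u + 3 • v = x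

/-- `ℙ`-torsion-free commutative monoid. -/
def PTorsionFree (P : Set ℕ) (M : Type u) [AddCommMonoid M] : Prop :=
  ∀ p ∈ P, ∀ x y : M, p • x = p • y → x = y

/-- `ℙ`-unperforated commutative monoid (w.r.t. the algebraic preorder). -/
def PUnperforated (P : Set ℕ) (M : Type u) [AddCommMonoid M] : Prop :=
  ∀ p ∈ P, ∀ x y : M, AlgLE (p • x) (p • y) → AlgLE x y

/-- The algebraic preorder is antisymmetric. -/
def AlgLEAntisymm (M : Type u) [AddCommMonoid M] : Prop :=
  ∀ x y : M, AlgLE x y → AlgLE y x → x = y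

theorem AlgLE.map {M N : Type u} [AddCommMonoid M] [AddCommMonoid N] (f : M →+ N) {x y : M}
    (h : AlgLE x y) : AlgLE (f x) (f y) := by
  obtain ⟨z, rfl⟩ := h
  exact ⟨f z, (map_add f x z).symm⟩

theorem AlgLEAntisymm.isConical {M : Type u} [AddCommMonoid M] (h : AlgLEAntisymm M) :
    IsConical M := by
  intro x y hxy
  exact ⟨h x 0 ⟨y, hxy⟩ ⟨x, zero_add x⟩, h y 0 ⟨x, by rw [add_comm, hxy]⟩ ⟨y, zero_add y⟩⟩

theorem AlgLEAntisymm.isOrderEmbeddingHom {M N : Type u} [AddCommMonoid M] [AddCommMonoid N]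
    (h : AlgLEAntisymm M) (f : M →+ N) (hf : ∀ x y, AlgLE (f x) (f y) → AlgLE x y) :
    IsOrderEmbeddingHom f := by
  refine ⟨fun x y hxy => h x y (hf x y ?_) (hf y x ?_), fun x y => ⟨AlgLE.map f, hf x y⟩⟩
  · exact ⟨0, by rw [add_zero, hxy]⟩
  · exact ⟨0, by rw [add_zero, hxy]⟩

theorem IsOrderEmbeddingHom.comp {M N K : Type u} [AddCommMonoid M] [AddCommMonoid N]
    [AddCommMonoid K] {g : N →+ K} {f : M →+ N} (hg : IsOrderEmbeddingHom g)
    (hf : IsOrderEmbeddingHom f) : IsOrderEmbeddingHom (g.comp f) :=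
  ⟨hg.1.comp hf.1, fun x y => (hf.2 x y).trans (hg.2 _ _)⟩

/-- The largest congruence compatible with a relation `L`. -/
def syntacticCon {M F : Type u} [AddCommMonoid F] (L : F → M → Prop) : AddCon F where
  r x y := ∀ w q, L (w + x) q ↔ L (w + y) q
  iseqv := ⟨fun _ _ _ => Iff.rfl, fun h w q => (h w q).symm,
    fun h₁ h₂ w q => (h₁ w q).trans (h₂ w q)⟩
  add' := by
    intro x y z t hxy hzt w q
    rw [← add_assoc, hzt (w + x) q, add_right_comm, hxy (w + t) q, add_right_comm, add_assoc]

/-- A relation `L x q`, to be read as "`q` is an upper bound of `x`", on an extension `F` of `M`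
gives rise to an antisymmetric quotient of `F` into which `M` order-embeds. -/
theorem exists_antisymm_quotient {M F : Type u} [AddCommMonoid M] [AddCommMonoid F]
    (hM : AlgLEAntisymm M) (i : M →+ F) (L : F → M → Prop)
    (hL : ∀ x y q, L (x + y) q → L x q) (hi : ∀ m q, L (i m) q ↔ AlgLE m q) :
    ∃ (N : Type u) (_ : AddCommMonoid N) (g : F →+ N), AlgLEAntisymm N ∧
      IsOrderEmbeddingHom (g.comp i) ∧
      ∀ x y, (∀ w q, L (w + x) q ↔ L (w + y) q) → g x = g y := by
  refine ⟨(syntacticCon L).Quotient, inferInstance, (syntacticCon L).mk', ?_,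
    hM.isOrderEmbeddingHom _ ?_, fun x y h => (AddCon.eq _).2 h⟩
  · have mono : ∀ x y : F, AlgLE (x : (syntacticCon L).Quotient) y →
        ∀ w q, L (w + y) q → L (w + x) q := by
      rintro x y ⟨z, hz⟩ w q h
      obtain ⟨z, rfl⟩ := (syntacticCon L).mk'_surjective z
      have hc : syntacticCon L (x + z) y := (AddCon.eq _).1 hz
      refine hL _ z q ?_
      rw [add_assoc]
      exact (hc w q).2 h
    intro x y hxy hyx
    obtain ⟨x, rfl⟩ := (syntacticCon L).mk'_surjective x
    obtain ⟨y, rfl⟩ := (syntacticCon L).mk'_surjective y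
    exact (AddCon.eq _).2 fun w q => ⟨mono y x hyx w q, mono x y hxy w q⟩
  · rintro x y ⟨z, hz⟩
    obtain ⟨z, rfl⟩ := (syntacticCon L).mk'_surjective z
    have hc : syntacticCon L (i x + z) (i y) := (AddCon.eq _).1 hz
    have h := (hc 0 y).2 (by rw [zero_add]; exact (hi y y).2 ⟨0, add_zero y⟩)
    rw [zero_add] at h
    exact (hi x y).1 (hL _ _ _ h)

/-- An instance, with parameters in `M`, of refinement, (WSD), or normal divisibility. -/
inductive ExtensionProblem (M : Type u) [AddCommMonoid M] : Type u
  | refinement (a₀ a₁ b₀ b₁ : M) (h : a₀ + a₁ = b₀ + b₁)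
  | weakSum (a₀ a₁ b c : M) (h : a₀ + a₁ + c = b + c)
  | division (p : ℕ) (hp : 0 < p) (a : M)

namespace ExtensionProblem

/-- The problem has a solution in the codomain of `f`. -/
def IsSolved {M N : Type u} [AddCommMonoid M] [AddCommMonoid N] (f : M →+ N) :
    ExtensionProblem M → Prop
  | refinement a₀ a₁ b₀ b₁ _ => ∃ c₀₀ c₀₁ c₁₀ c₁₁ : N,
      f a₀ = c₀₀ + c₀₁ ∧ f a₁ = c₁₀ + c₁₁ ∧ f b₀ = c₀₀ + c₁₀ ∧ f b₁ = c₀₁ + c₁₁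
  | weakSum a₀ a₁ b c _ => ∃ x₀ x₁ : N,
      f a₀ + f c = x₀ + f c ∧ f a₁ + f c = x₁ + f c ∧ f b = x₀ + x₁
  | division p _ a => ∃ u : N, p • u = f a ∧ ∀ x y : M, x + a = y + a → f x + u = f y + u

/-- The image of a problem under a homomorphism. -/
def map {M N : Type u} [AddCommMonoid M] [AddCommMonoid N] (f : M →+ N) :
    ExtensionProblem M → ExtensionProblem N
  | refinement a₀ a₁ b₀ b₁ h =>
      refinement (f a₀) (f a₁) (f b₀) (f b₁) (by rw [← map_add, h, map_add])
  | weakSum a₀ a₁ b c h =>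
      weakSum (f a₀) (f a₁) (f b) (f c) (by rw [← map_add, ← map_add, h, map_add])
  | division p hp a => division p hp (f a)

variable {M N K : Type u} [AddCommMonoid M] [AddCommMonoid N] [AddCommMonoid K]

theorem isSolved_comp_of_map {f : M →+ N} {g : N →+ K} {P : ExtensionProblem M}
    (h : IsSolved g (P.map f)) : IsSolved (g.comp f) P := by
  cases P with
  | refinement => exact h
  | weakSum => exact h
  | division p hp a =>
    obtain ⟨u, hu, hxy⟩ := h
    exact ⟨u, hu, fun x y e => hxy (f x) (f y) (by rw [← map_add, e, map_add])⟩

theorem IsSolved.comp {f : M →+ N} (g : N →+ K) {P : ExtensionProblem M}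
    (h : IsSolved f P) : IsSolved (g.comp f) P := by
  cases P with
  | refinement =>
    obtain ⟨c₀₀, c₀₁, c₁₀, c₁₁, h₁, h₂, h₃, h₄⟩ := h
    exact ⟨g c₀₀, g c₀₁, g c₁₀, g c₁₁, by simp [h₁], by simp [h₂], by simp [h₃], by simp [h₄]⟩
  | weakSum =>
    obtain ⟨x₀, x₁, h₁, h₂, h₃⟩ := h
    exact ⟨g x₀, g x₁, by simp [← map_add, h₁], by simp [← map_add, h₂], by simp [h₃]⟩
  | division =>
    obtain ⟨u, hu, hxy⟩ := h
    exact ⟨g u, by simp [← map_nsmul, hu], fun x y e => by simp [← map_add, hxy x y e]⟩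

end ExtensionProblem

open ExtensionProblem

theorem exists_isSolved_division {M : Type u} [AddCommMonoid M] (hM : AlgLEAntisymm M)
    (p : ℕ) (hp : 0 < p) (a : M) :
    ∃ (N : Type u) (_ : AddCommMonoid N) (f : M →+ N),
      AlgLEAntisymm N ∧ IsOrderEmbeddingHom f ∧ IsSolved f (division p hp a) := by
  obtain ⟨N, _, g, hN, hg, hrel⟩ := exists_antisymm_quotient hM (AddMonoidHom.inl M ℕ)
    (fun x q => ∃ j z, x.2 ≤ p * j ∧ x.1 + j • a + z = q)
    (by
      rintro ⟨m, i⟩ ⟨m', i'⟩ q ⟨j, z, hj, rfl⟩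
      simp only [Prod.mk_add_mk] at hj ⊢
      exact ⟨j, m' + z, by omega, by abel⟩)
    (by
      intro m q
      constructor
      · rintro ⟨j, z, -, rfl⟩
        exact ⟨j • a + z, by simp [add_assoc]⟩
      · rintro ⟨z, rfl⟩
        exact ⟨0, z, by simp, by simp⟩)
  refine ⟨N, _, _, hN, hg, g (0, 1), ?_, ?_⟩
  · rw [← map_nsmul]
    apply hrel
    rintro ⟨m, i⟩ q
    simp only [Prod.smul_mk, smul_zero, smul_eq_mul, mul_one, Prod.mk_add_mk, add_zero,
      AddMonoidHom.inl_apply]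
    constructor
    · rintro ⟨j, z, hj, rfl⟩
      obtain _ | j := j
      · omega
      · exact ⟨j, z, by rw [mul_add] at hj; omega, by rw [succ_nsmul]; abel⟩
    · rintro ⟨j, z, hj, rfl⟩
      exact ⟨j + 1, z, by rw [mul_add]; omega, by rw [succ_nsmul]; abel⟩
  · have key : ∀ x y : M, x + a = y + a → ∀ w : M × ℕ, ∀ q,
        (∃ j z, (w + (x, 1)).2 ≤ p * j ∧ (w + (x, 1)).1 + j • a + z = q) →
        (∃ j z, (w + (y, 1)).2 ≤ p * j ∧ (w + (y, 1)).1 + j • a + z = q) := by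
      rintro x y hxy ⟨m, i⟩ q ⟨j, z, hj, rfl⟩
      simp only [Prod.mk_add_mk] at hj ⊢
      obtain _ | j := j
      · omega
      · refine ⟨j + 1, z, hj, ?_⟩
        rw [succ_nsmul, show m + y + (j • a + a) + z = m + j • a + z + (y + a) by abel, ← hxy]
        abel
    intro x y hxy
    simp only [AddMonoidHom.comp_apply, AddMonoidHom.inl_apply, ← map_add, Prod.mk_add_mk,
      add_zero, zero_add]
    exact hrel _ _ fun w q => ⟨key x y hxy w q, key y x hxy.symm w q⟩

theorem exists_isSolved_refinement {M : Type u} [AddCommMonoid M] (hM : AlgLEAntisymm M)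
    (a₀ a₁ b₀ b₁ : M) (h : a₀ + a₁ = b₀ + b₁) :
    ∃ (N : Type u) (_ : AddCommMonoid N) (f : M →+ N),
      AlgLEAntisymm N ∧ IsOrderEmbeddingHom f ∧ IsSolved f (refinement a₀ a₁ b₀ b₁ h) := by
  obtain ⟨N, _, g, hN, hg, hrel⟩ := exists_antisymm_quotient hM
    (AddMonoidHom.inl M (ℕ × ℕ × ℕ × ℕ))
    (fun x q => ∃ r₀ r₁ s₀ s₁ z, x.2.1 ≤ r₀ + s₀ ∧ x.2.2.1 ≤ r₀ + s₁ ∧ x.2.2.2.1 ≤ r₁ + s₀ ∧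
      x.2.2.2.2 ≤ r₁ + s₁ ∧ x.1 + r₀ • a₀ + r₁ • a₁ + s₀ • b₀ + s₁ • b₁ + z = q)
    (by
      rintro ⟨m, n₁, n₂, n₃, n₄⟩ ⟨m', n₁', n₂', n₃', n₄'⟩ q ⟨r₀, r₁, s₀, s₁, z, h₁, h₂, h₃, h₄, rfl⟩
      simp only [Prod.mk_add_mk] at h₁ h₂ h₃ h₄ ⊢
      exact ⟨r₀, r₁, s₀, s₁, m' + z, by omega, by omega, by omega, by omega, by abel⟩)
    (by
      intro m q
      constructor
      · rintro ⟨r₀, r₁, s₀, s₁, z, -, -, -, -, rfl⟩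
        exact ⟨r₀ • a₀ + r₁ • a₁ + s₀ • b₀ + s₁ • b₁ + z, by simp [add_assoc]⟩
      · rintro ⟨z, rfl⟩
        exact ⟨0, 0, 0, 0, z, by simp, by simp, by simp, by simp, by simp⟩)
  refine ⟨N, _, _, hN, hg, g (0, 1, 0, 0, 0), g (0, 0, 1, 0, 0), g (0, 0, 0, 1, 0),
    g (0, 0, 0, 0, 1), ?_, ?_, ?_, ?_⟩
  all_goals
    rw [← map_add]
    apply hrel
    rintro ⟨m, n₁, n₂, n₃, n₄⟩ q
    simp only [Prod.mk_add_mk, add_zero, zero_add, AddMonoidHom.inl_apply, Prod.mk_zero_zero]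
    constructor
  · rintro ⟨r₀, r₁, s₀, s₁, z, h₁, h₂, h₃, h₄, rfl⟩
    exact ⟨r₀ + 1, r₁, s₀, s₁, z, by omega, by omega, by omega, by omega, by
      rw [succ_nsmul]; abel⟩
  · rintro ⟨r₀, r₁, s₀, s₁, z, h₁, h₂, h₃, h₄, rfl⟩
    obtain _ | r₀ := r₀
    · obtain ⟨s₀, rfl⟩ : ∃ s, s₀ = s + 1 := ⟨s₀ - 1, by omega⟩
      obtain ⟨s₁, rfl⟩ : ∃ s, s₁ = s + 1 := ⟨s₁ - 1, by omega⟩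
      refine ⟨0, r₁ + 1, s₀, s₁, z, by omega, by omega, by omega, by omega, ?_⟩
      simp only [succ_nsmul, zero_nsmul]
      trans m + r₁ • a₁ + s₀ • b₀ + s₁ • b₁ + z + (a₀ + a₁)
      · abel
      · rw [h]; abel
    · exact ⟨r₀, r₁, s₀, s₁, z, by omega, by omega, by omega, by omega, by
        rw [succ_nsmul]; abel⟩
  · rintro ⟨r₀, r₁, s₀, s₁, z, h₁, h₂, h₃, h₄, rfl⟩
    exact ⟨r₀, r₁ + 1, s₀, s₁, z, by omega, by omega, by omega, by omega, by
      rw [succ_nsmul]; abel⟩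
  · rintro ⟨r₀, r₁, s₀, s₁, z, h₁, h₂, h₃, h₄, rfl⟩
    obtain _ | r₁ := r₁
    · obtain ⟨s₀, rfl⟩ : ∃ s, s₀ = s + 1 := ⟨s₀ - 1, by omega⟩
      obtain ⟨s₁, rfl⟩ : ∃ s, s₁ = s + 1 := ⟨s₁ - 1, by omega⟩
      refine ⟨r₀ + 1, 0, s₀, s₁, z, by omega, by omega, by omega, by omega, ?_⟩
      simp only [succ_nsmul, zero_nsmul]
      trans m + r₀ • a₀ + s₀ • b₀ + s₁ • b₁ + z + (a₀ + a₁)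
      · abel
      · rw [h]; abel
    · exact ⟨r₀, r₁, s₀, s₁, z, by omega, by omega, by omega, by omega, by
        rw [succ_nsmul]; abel⟩
  · rintro ⟨r₀, r₁, s₀, s₁, z, h₁, h₂, h₃, h₄, rfl⟩
    exact ⟨r₀, r₁, s₀ + 1, s₁, z, by omega, by omega, by omega, by omega, by
      rw [succ_nsmul]; abel⟩
  · rintro ⟨r₀, r₁, s₀, s₁, z, h₁, h₂, h₃, h₄, rfl⟩
    obtain _ | s₀ := s₀
    · obtain ⟨r₀, rfl⟩ : ∃ s, r₀ = s + 1 := ⟨r₀ - 1, by omega⟩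
      obtain ⟨r₁, rfl⟩ : ∃ s, r₁ = s + 1 := ⟨r₁ - 1, by omega⟩
      refine ⟨r₀, r₁, 0, s₁ + 1, z, by omega, by omega, by omega, by omega, ?_⟩
      simp only [succ_nsmul, zero_nsmul]
      trans m + r₀ • a₀ + r₁ • a₁ + s₁ • b₁ + z + (b₀ + b₁)
      · abel
      · rw [← h]; abel
    · exact ⟨r₀, r₁, s₀, s₁, z, by omega, by omega, by omega, by omega, by
        rw [succ_nsmul]; abel⟩
  · rintro ⟨r₀, r₁, s₀, s₁, z, h₁, h₂, h₃, h₄, rfl⟩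
    exact ⟨r₀, r₁, s₀, s₁ + 1, z, by omega, by omega, by omega, by omega, by
      rw [succ_nsmul]; abel⟩
  · rintro ⟨r₀, r₁, s₀, s₁, z, h₁, h₂, h₃, h₄, rfl⟩
    obtain _ | s₁ := s₁
    · obtain ⟨r₀, rfl⟩ : ∃ s, r₀ = s + 1 := ⟨r₀ - 1, by omega⟩
      obtain ⟨r₁, rfl⟩ : ∃ s, r₁ = s + 1 := ⟨r₁ - 1, by omega⟩
      refine ⟨r₀, r₁, s₀ + 1, 0, z, by omega, by omega, by omega, by omega, ?_⟩
      simp only [succ_nsmul, zero_nsmul]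
      trans m + r₀ • a₀ + r₁ • a₁ + s₀ • b₀ + z + (b₀ + b₁)
      · abel
      · rw [← h]; abel
    · exact ⟨r₀, r₁, s₀, s₁, z, by omega, by omega, by omega, by omega, by
        rw [succ_nsmul]; abel⟩

/-- `WeakSumBound a₀ a₁ b c m i j q` means that `q` is an upper bound of `m + i • x₀ + j • x₁`,
where `x₀` and `x₁` are generic solutions of the instance of (WSD) given by `a₀`, `a₁`, `b`, `c`:
`k` copies of `x₀ + x₁` are turned into `b`, and the remaining `x₀` and `x₁` are turned into `a₀`
and `a₁` in the presence of `c`. -/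
def WeakSumBound {M : Type u} [AddCommMonoid M] (a₀ a₁ b c m : M) (i j : ℕ) (q : M) : Prop :=
  ∃ (k i' j' : ℕ) (s t : M), i ≤ k + i' ∧ j ≤ k + j' ∧
    ((∃ d, m + k • b + s = d + c) ∨ i' = 0 ∧ j' = 0) ∧
    m + k • b + s + i' • a₀ + j' • a₁ + t = q

namespace WeakSumBound

variable {M : Type u} [AddCommMonoid M] {a₀ a₁ b c m : M} {i j : ℕ} {q : M}

theorem swap (h : WeakSumBound a₀ a₁ b c m i j q) : WeakSumBound a₁ a₀ b c m j i q := by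
  obtain ⟨k, i', j', s, t, hi, hj, hc, rfl⟩ := h
  exact ⟨k, j', i', s, t, hj, hi, hc.imp_right And.symm, by abel⟩

theorem of_add (m' : M) (i' j' : ℕ) (h : WeakSumBound a₀ a₁ b c (m + m') (i + i') (j + j') q) :
    WeakSumBound a₀ a₁ b c m i j q := by
  obtain ⟨k, i', j', s, t, hi, hj, hc, rfl⟩ := h
  refine ⟨k, i', j', m' + s, t, by omega, by omega, hc.imp_left ?_, by abel⟩
  rintro ⟨d, hd⟩
  exact ⟨d, by rw [← hd]; abel⟩

theorem zero_zero_iff : WeakSumBound a₀ a₁ b c m 0 0 q ↔ AlgLE m q := by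
  constructor
  · rintro ⟨k, i', j', s, t, -, -, -, rfl⟩
    exact ⟨k • b + s + i' • a₀ + j' • a₁ + t, by abel⟩
  · rintro ⟨z, rfl⟩
    exact ⟨0, 0, 0, 0, z, by simp, by simp, by simp, by simp⟩

theorem add_iff (h : a₀ + a₁ + c = b + c) :
    WeakSumBound a₀ a₁ b c (m + b) i j q ↔ WeakSumBound a₀ a₁ b c m (i + 1) (j + 1) q := by
  constructor
  · rintro ⟨k, i', j', s, t, hi, hj, hc, rfl⟩
    refine ⟨k + 1, i', j', s, t, by omega, by omega, hc.imp_left ?_, by rw [succ_nsmul]; abel⟩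
    rintro ⟨d, hd⟩
    exact ⟨d, by rw [← hd, succ_nsmul]; abel⟩
  · rintro ⟨k, i', j', s, t, hi, hj, hc, rfl⟩
    obtain _ | k := k
    · obtain ⟨i', rfl⟩ : ∃ n, i' = n + 1 := ⟨i' - 1, by omega⟩
      obtain ⟨j', rfl⟩ : ∃ n, j' = n + 1 := ⟨j' - 1, by omega⟩
      obtain ⟨d, hd⟩ := hc.resolve_right (by omega)
      rw [zero_nsmul, add_zero] at hd ⊢
      refine ⟨0, i', j', s, t, by omega, by omega, Or.inl ⟨d + b, ?_⟩, ?_⟩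
      · rw [zero_nsmul, add_zero, add_right_comm, hd, add_right_comm]
      · simp only [succ_nsmul, zero_nsmul]
        trans (m + s) + b + (i' • a₀ + j' • a₁ + t)
        · abel
        trans (m + s) + (a₀ + a₁) + (i' • a₀ + j' • a₁ + t)
        · rw [hd, add_assoc d c b, add_comm c b, ← h]; abel
        · abel
    · refine ⟨k, i', j', s, t, by omega, by omega, hc.imp_left ?_, by rw [succ_nsmul]; abel⟩
      rintro ⟨d, hd⟩
      exact ⟨d, by rw [← hd, succ_nsmul]; abel⟩

theorem add_left_iff (h : a₀ + a₁ + c = b + c) :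
    WeakSumBound a₀ a₁ b c (m + (a₀ + c)) i j q ↔ WeakSumBound a₀ a₁ b c (m + c) (i + 1) j q := by
  constructor
  · rintro ⟨k, i', j', s, t, hi, hj, hc, rfl⟩
    exact ⟨k, i' + 1, j', s, t, by omega, by omega, Or.inl ⟨m + k • b + s, by abel⟩,
      by rw [succ_nsmul]; abel⟩
  · rintro ⟨k, i', j', s, t, hi, hj, -, rfl⟩
    obtain _ | i' := i'
    · obtain ⟨k, rfl⟩ : ∃ n, k = n + 1 := ⟨k - 1, by omega⟩
      refine ⟨k, 0, j' + 1, 0, s + t, by omega, by omega, Or.inl ⟨m + a₀ + k • b, by abel⟩, ?_⟩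
      simp only [succ_nsmul, zero_nsmul]
      trans m + k • b + s + j' • a₁ + t + (a₀ + a₁ + c)
      · abel
      · rw [h]; abel
    · exact ⟨k, i', j', s, t, by omega, by omega, Or.inl ⟨m + a₀ + k • b + s, by abel⟩,
        by rw [succ_nsmul]; abel⟩

end WeakSumBound

theorem exists_isSolved_weakSum {M : Type u} [AddCommMonoid M] (hM : AlgLEAntisymm M)
    (a₀ a₁ b c : M) (h : a₀ + a₁ + c = b + c) :
    ∃ (N : Type u) (_ : AddCommMonoid N) (f : M →+ N),
      AlgLEAntisymm N ∧ IsOrderEmbeddingHom f ∧ IsSolved f (weakSum a₀ a₁ b c h) := by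
  obtain ⟨N, _, g, hN, hg, hrel⟩ := exists_antisymm_quotient hM
    (AddMonoidHom.inl M (ℕ × ℕ)) (fun x q => WeakSumBound a₀ a₁ b c x.1 x.2.1 x.2.2 q)
    (fun x y q => WeakSumBound.of_add y.1 y.2.1 y.2.2)
    (fun m q => WeakSumBound.zero_zero_iff)
  refine ⟨N, _, _, hN, hg, g (0, 1, 0), g (0, 0, 1), ?_, ?_, ?_⟩
  all_goals
    simp only [AddMonoidHom.comp_apply, AddMonoidHom.inl_apply, ← map_add]
    apply hrel
    rintro ⟨m, i, j⟩ q
    simp only [Prod.mk_add_mk, add_zero, zero_add]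
  · exact WeakSumBound.add_left_iff h
  · have h' : a₁ + a₀ + c = b + c := by rw [add_comm a₁, h]
    exact ⟨fun H => ((WeakSumBound.add_left_iff h').1 H.swap).swap,
      fun H => ((WeakSumBound.add_left_iff h').2 H.swap).swap⟩
  · exact WeakSumBound.add_iff h

theorem exists_isSolved {M : Type u} [AddCommMonoid M] (hM : AlgLEAntisymm M)
    (P : ExtensionProblem M) :
    ∃ (N : Type u) (_ : AddCommMonoid N) (f : M →+ N),
      AlgLEAntisymm N ∧ IsOrderEmbeddingHom f ∧ IsSolved f P := by
  cases P with
  | refinement a₀ a₁ b₀ b₁ h => exact exists_isSolved_refinement hM a₀ a₁ b₀ b₁ h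
  | weakSum a₀ a₁ b c h => exact exists_isSolved_weakSum hM a₀ a₁ b c h
  | division p hp a => exact exists_isSolved_division hM p hp a

theorem exists_isSolved_finset {M : Type u} [AddCommMonoid M] (hM : AlgLEAntisymm M)
    (S : Finset (ExtensionProblem M)) :
    ∃ (N : Type u) (_ : AddCommMonoid N) (f : M →+ N),
      AlgLEAntisymm N ∧ IsOrderEmbeddingHom f ∧ ∀ P ∈ S, IsSolved f P := by
  classical
  induction S using Finset.induction_on with
  | empty =>
    exact ⟨M, _, AddMonoidHom.id M, hM, hM.isOrderEmbeddingHom _ fun _ _ => id, by simp⟩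
  | insert P S _ ih =>
    obtain ⟨N, _, f, hN, hf, hS⟩ := ih
    obtain ⟨K, _, g, hK, hg, hP⟩ := exists_isSolved hN (P.map f)
    refine ⟨K, _, g.comp f, hK, hg.comp hf, fun Q hQ => ?_⟩
    obtain rfl | hQ := Finset.mem_insert.1 hQ
    · exact isSolved_comp_of_map hP
    · exact (hS Q hQ).comp g

/-- Eventual equality along a filter, as a congruence on a product. -/
def eventualCon {ι : Type u} (l : Filter ι) (G : ι → Type u) [∀ i, AddCommMonoid (G i)] :
    AddCon (∀ i, G i) where
  r x y := ∀ᶠ i in l, x i = y i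
  iseqv := ⟨fun _ => Filter.Eventually.of_forall fun _ => rfl,
    fun h => h.mono fun _ => Eq.symm, fun h₁ h₂ => (h₁.and h₂).mono fun _ h => h.1.trans h.2⟩
  add' h₁ h₂ := (h₁.and h₂).mono fun _ h => congrArg₂ (· + ·) h.1 h.2

theorem exists_all_isSolved {M : Type u} [AddCommMonoid M] (hM : AlgLEAntisymm M) :
    ∃ (N : Type u) (_ : AddCommMonoid N) (f : M →+ N),
      AlgLEAntisymm N ∧ IsOrderEmbeddingHom f ∧ ∀ P, IsSolved f P := by
  classical
  choose G inst f hG hf hS using exists_isSolved_finset hM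
  let C := eventualCon Filter.atTop G
  have hmem : ∀ P : ExtensionProblem M, ∀ᶠ S : Finset (ExtensionProblem M) in Filter.atTop,
      P ∈ S := fun P =>
    (Filter.eventually_ge_atTop {P}).mono fun S h => h (Finset.mem_singleton_self P)
  have hsolve : ∀ P : ExtensionProblem M, ∀ᶠ S in Filter.atTop, IsSolved (f S) P := fun P =>
    (hmem P).mono fun S h => hS S P h
  have hex : ∀ {α : ∀ S, G S → Prop}, (∀ᶠ S in Filter.atTop, ∃ x, α S x) →
      ∃ x : ∀ S, G S, ∀ᶠ S in Filter.atTop, α S (x S) := by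
    intro α h
    refine ⟨fun S => if h : ∃ x, α S x then h.choose else 0, h.mono fun S h => ?_⟩
    simp only [dif_pos h]
    exact h.choose_spec
  refine ⟨C.Quotient, inferInstance, C.mk'.comp (AddMonoidHom.pi f), ?_,
    hM.isOrderEmbeddingHom _ ?_, ?_⟩
  · rintro x y ⟨z, hz⟩ ⟨w, hw⟩
    obtain ⟨x, rfl⟩ := C.mk'_surjective x
    obtain ⟨y, rfl⟩ := C.mk'_surjective y
    obtain ⟨z, rfl⟩ := C.mk'_surjective z
    obtain ⟨w, rfl⟩ := C.mk'_surjective w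
    have hz : C (x + z) y := (AddCon.eq _).1 hz
    have hw : C (y + w) x := (AddCon.eq _).1 hw
    exact (AddCon.eq _).2 ((Filter.Eventually.and hz hw).mono fun S h =>
      hG S _ _ ⟨z S, h.1⟩ ⟨w S, h.2⟩)
  · rintro x y ⟨z, hz⟩
    obtain ⟨z, rfl⟩ := C.mk'_surjective z
    have hz : C (AddMonoidHom.pi f x + z) (AddMonoidHom.pi f y) := (AddCon.eq _).1 hz
    obtain ⟨S, h⟩ := Filter.Eventually.exists hz
    exact ((hf S).2 x y).2 ⟨z S, h⟩
  · intro P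
    have hP := hsolve P
    cases P with
    | refinement a₀ a₁ b₀ b₁ h =>
      obtain ⟨c₀₀, h₁⟩ := hex hP
      obtain ⟨c₀₁, h₂⟩ := hex h₁
      obtain ⟨c₁₀, h₃⟩ := hex h₂
      obtain ⟨c₁₁, h₄⟩ := hex h₃
      exact ⟨C.mk' c₀₀, C.mk' c₀₁, C.mk' c₁₀, C.mk' c₁₁,
        (AddCon.eq _).2 (h₄.mono fun S h => h.1), (AddCon.eq _).2 (h₄.mono fun S h => h.2.1),
        (AddCon.eq _).2 (h₄.mono fun S h => h.2.2.1), (AddCon.eq _).2 (h₄.mono fun S h => h.2.2.2)⟩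
    | weakSum a₀ a₁ b c h =>
      obtain ⟨x₀, h₁⟩ := hex hP
      obtain ⟨x₁, h₂⟩ := hex h₁
      exact ⟨C.mk' x₀, C.mk' x₁, (AddCon.eq _).2 (h₂.mono fun S h => h.1),
        (AddCon.eq _).2 (h₂.mono fun S h => h.2.1), (AddCon.eq _).2 (h₂.mono fun S h => h.2.2)⟩
    | division p hp a =>
      obtain ⟨u, hu⟩ := hex hP
      exact ⟨C.mk' u, (AddCon.eq _).2 (hu.mono fun S h => h.1),
        fun x y e => (AddCon.eq _).2 (hu.mono fun S h => h.2 x y e)⟩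

section Chain

variable (G : ℕ → Type u) [∀ n, AddCommMonoid (G n)] (f : ∀ n, G n →+ G (n + 1))

/-- The transition maps of the directed system generated by a sequence of homomorphisms. -/
def chainMap (i j : ℕ) (h : i ≤ j) : G i →+ G j :=
  Nat.leRecOn (C := fun k => G i →+ G k) h (fun {k} φ => (f k).comp φ) (AddMonoidHom.id (G i))

theorem chainMap_self (i : ℕ) : chainMap G f i i le_rfl = AddMonoidHom.id (G i) :=
  Nat.leRecOn_self _

theorem chainMap_succ (i j : ℕ) (h : i ≤ j) :
    chainMap G f i (j + 1) (h.trans j.le_succ) = (f j).comp (chainMap G f i j h) :=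
  Nat.leRecOn_succ h _

theorem chainMap_chainMap (i j k : ℕ) (hij : i ≤ j) (hjk : j ≤ k) (x : G i) :
    chainMap G f j k hjk (chainMap G f i j hij x) = chainMap G f i k (hij.trans hjk) x := by
  induction k, hjk using Nat.le_induction with
  | base => simp [chainMap_self]
  | succ k hk ih => simp [chainMap_succ _ _ _ _ hk, chainMap_succ _ _ _ _ (hij.trans hk), ih]

theorem chainMap_isOrderEmbeddingHom (hf : ∀ n, IsOrderEmbeddingHom (f n)) (i j : ℕ)
    (h : i ≤ j) : IsOrderEmbeddingHom (chainMap G f i j h) := by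
  induction j, h using Nat.le_induction with
  | base =>
    rw [chainMap_self]
    exact ⟨fun _ _ => id, fun _ _ => Iff.rfl⟩
  | succ k hk ih =>
    rw [chainMap_succ _ _ _ _ hk]
    exact (hf k).comp ih

theorem exists_chain_union (hf : ∀ n, Function.Injective (f n)) :
    ∃ (N : Type u) (_ : AddCommMonoid N) (e : ∀ n, G n →+ N),
      (∀ n, Function.Injective (e n)) ∧ (∀ i j h x, e j (chainMap G f i j h x) = e i x) ∧
      ∀ x, ∃ n y, e n y = x := by
  let φ : ∀ i j, i ≤ j → G i →ₗ[ℕ] G j := fun i j h => (chainMap G f i j h).toNatLinearMap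
  have : DirectedSystem G (φ · · ·) :=
    ⟨fun i x => congrArg (· x) (chainMap_self G f i),
      fun k j i hij hjk x => chainMap_chainMap G f _ _ _ hij hjk x⟩
  have hinj : ∀ i j h, Function.Injective (chainMap G f i j h) := by
    intro i j h
    induction j, h using Nat.le_induction with
    | base => rw [chainMap_self]; exact fun _ _ => id
    | succ k hk ih => rw [chainMap_succ _ _ _ _ hk]; exact (hf k).comp ih
  refine ⟨Module.DirectLimit G φ, inferInstance,
    fun n => (Module.DirectLimit.of ℕ ℕ G φ n).toAddMonoidHom, ?_, ?_, ?_⟩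
  · intro n x y h
    obtain ⟨j, hj, e⟩ := Module.DirectLimit.exists_eq_of_of_eq h
    exact hinj n j hj e
  · intro i j h x
    exact Module.DirectLimit.of_f
  · exact Module.DirectLimit.exists_of

theorem exists_of_chain (hG : ∀ n, AlgLEAntisymm (G n)) (hf : ∀ n, IsOrderEmbeddingHom (f n))
    (hs : ∀ n P, IsSolved (f n) P) :
    ∃ (N : Type u) (_ : AddCommMonoid N),
      IsConical N ∧ IsNormallyDivisible N ∧ IsRefinementMonoid N ∧ WSD N ∧
      ∃ g : G 0 →+ N, IsOrderEmbeddingHom g := by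
  classical
  obtain ⟨N, _, e, hinj, hcomp, hsurj⟩ := exists_chain_union G f fun n => (hf n).1
  have hstep : ∀ n x, e (n + 1) (f n x) = e n x := by
    intro n x
    rw [← hcomp n (n + 1) n.le_succ x, chainMap_succ G f n n le_rfl, chainMap_self]
    rfl
  have hlift : ∀ X : Finset N, ∃ n, ∀ x ∈ X, ∃ y, e n y = x := by
    intro X
    induction X using Finset.induction_on with
    | empty => exact ⟨0, by simp⟩
    | insert x X _ ih =>
      obtain ⟨n, hn⟩ := ih
      obtain ⟨m, y, rfl⟩ := hsurj x
      refine ⟨max m n, fun z hz => ?_⟩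
      obtain rfl | hz := Finset.mem_insert.1 hz
      · exact ⟨_, hcomp m _ (le_max_left m n) y⟩
      · obtain ⟨w, rfl⟩ := hn z hz
        exact ⟨_, hcomp n _ (le_max_right m n) w⟩
  refine ⟨N, _, ?_, ?_, ?_, ?_, e 0, (hG 0).isOrderEmbeddingHom _ ?_⟩
  · intro x y hxy
    obtain ⟨n, hn⟩ := hlift {x, y}
    obtain ⟨x, rfl⟩ := hn x (by simp)
    obtain ⟨y, rfl⟩ := hn y (by simp)
    obtain ⟨rfl, rfl⟩ := (hG n).isConical x y (hinj n (by simpa using hxy))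
    simp
  · intro p hp X a
    obtain ⟨n, hn⟩ := hlift (insert a X)
    obtain ⟨a, rfl⟩ := hn a (by simp)
    obtain ⟨u, hu, hX⟩ := hs n (division p hp a)
    refine ⟨e (n + 1) u, by rw [← map_nsmul, hu, hstep], fun x hx y hy hxy => ?_⟩
    obtain ⟨x, rfl⟩ := hn x (by simp [hx])
    obtain ⟨y, rfl⟩ := hn y (by simp [hy])
    simp only [← map_add] at hxy
    rw [← hstep n x, ← hstep n y, ← map_add, hX x y (hinj n hxy), map_add]
  · intro a₀ a₁ b₀ b₁ h
    obtain ⟨n, hn⟩ := hlift {a₀, a₁, b₀, b₁}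
    obtain ⟨a₀, rfl⟩ := hn a₀ (by simp)
    obtain ⟨a₁, rfl⟩ := hn a₁ (by simp)
    obtain ⟨b₀, rfl⟩ := hn b₀ (by simp)
    obtain ⟨b₁, rfl⟩ := hn b₁ (by simp)
    simp only [← map_add] at h
    obtain ⟨c₀₀, c₀₁, c₁₀, c₁₁, h₁, h₂, h₃, h₄⟩ := hs n (refinement a₀ a₁ b₀ b₁ (hinj n h))
    refine ⟨e (n + 1) c₀₀, e (n + 1) c₀₁, e (n + 1) c₁₀, e (n + 1) c₁₁, ?_⟩
    simp only [← hstep n, h₁, h₂, h₃, h₄, map_add, and_self]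
  · intro a₀ a₁ b c h
    obtain ⟨n, hn⟩ := hlift {a₀, a₁, b, c}
    obtain ⟨a₀, rfl⟩ := hn a₀ (by simp)
    obtain ⟨a₁, rfl⟩ := hn a₁ (by simp)
    obtain ⟨b, rfl⟩ := hn b (by simp)
    obtain ⟨c, rfl⟩ := hn c (by simp)
    simp only [← map_add] at h
    obtain ⟨x₀, x₁, h₁, h₂, h₃⟩ := hs n (weakSum a₀ a₁ b c (hinj n h))
    refine ⟨e (n + 1) x₀, e (n + 1) x₁, ?_⟩
    simp only [← hstep n, ← map_add, h₁, h₂, h₃, and_self]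
  · rintro x y ⟨z, hz⟩
    obtain ⟨n, z, rfl⟩ := hsurj z
    rw [← hcomp 0 n n.zero_le x, ← hcomp 0 n n.zero_le y, ← map_add] at hz
    exact ((chainMap_isOrderEmbeddingHom G f hf 0 n n.zero_le).2 x y).2 ⟨z, hinj n hz⟩

end Chain

/-- A commutative monoid whose algebraic preorder is antisymmetric. -/
structure AntisymmMonoid : Type (u + 1) where
  /-- The underlying type. -/
  carrier : Type u
  [inst : AddCommMonoid carrier]
  antisymm : AlgLEAntisymm carrier

attribute [instance] AntisymmMonoid.inst

theorem AntisymmMonoid.exists_extension (A : AntisymmMonoid.{u}) :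
    ∃ (B : AntisymmMonoid.{u}) (f : A.carrier →+ B.carrier),
      IsOrderEmbeddingHom f ∧ ∀ P, IsSolved f P := by
  obtain ⟨N, _, f, hN, hf, hs⟩ := exists_all_isSolved A.antisymm
  exact ⟨⟨N, hN⟩, f, hf, hs⟩

theorem AntisymmMonoid.exists_sequence (A₀ : AntisymmMonoid.{u}) :
    ∃ (A : ℕ → AntisymmMonoid.{u}) (_ : A 0 = A₀)
      (φ : ∀ n, (A n).carrier →+ (A (n + 1)).carrier),
      ∀ n, IsOrderEmbeddingHom (φ n) ∧ ∀ P, IsSolved (φ n) P := by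
  choose B f hf using AntisymmMonoid.exists_extension.{u}
  exact ⟨fun n => Nat.rec A₀ (fun _ C => B C) n, rfl, fun n => f _, fun n => hf _⟩

theorem AntisymmMonoid.exists_orderEmbedding (A₀ : AntisymmMonoid.{u}) :
    ∃ (N : Type u) (_ : AddCommMonoid N),
      IsConical N ∧ IsNormallyDivisible N ∧ IsRefinementMonoid N ∧ WSD N ∧
      ∃ f : A₀.carrier →+ N, IsOrderEmbeddingHom f := by
  obtain ⟨A, rfl, φ, hφ⟩ := A₀.exists_sequence
  exact exists_of_chain (fun n => (A n).carrier) φ (fun n => (A n).antisymm)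
    (fun n => (hφ n).1) fun n => (hφ n).2

/-- Every antisymmetric cone admits an order-embedding into a normally
divisible refinement cone satisfying (WSD). -/
theorem antisymmetric_cone_orderEmbeds_into_WSD_cone
    (M : Type u) [AddCommMonoid M] (hM : IsConical M)
    (hanti : ∀ x y : M, AlgLE x y → AlgLE y x → x = y) :
    ∃ (N : Type u) (_ : AddCommMonoid N),
      IsConical N ∧ IsNormallyDivisible N ∧ IsRefinementMonoid N ∧ WSD N ∧
      ∃ f : M →+ N, IsOrderEmbeddingHom f := by
  exact AntisymmMonoid.exists_orderEmbedding ⟨M, hanti⟩
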